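/- arXiv:math/0509436 — 2 statements merged into one kernel-verified Lean document; each statement's English description precedes it below -/
import Mathlib

section
/- Let a > 0 and let f ∈ W^{2,∞}(ℝ^{n+1}_+), i.e. f is a function on ℝ^n × (0,∞) that is bounded together with its first and second order derivatives. Define H_a(t) = ∫_{ℝ^n} f(x,t)^2 G_a(x,t) dx, D_a(t) = ∫_{ℝ^n} |∇f(x,t)|^2 G_a(x,t) dx, and N_a(t) = 2(t+a) D_a(t)/H_a(t). Then at every t > 0 where H_a(t) > 0, the derivative of N_a satisfies Ṅ_a(t) ≥ −((t+a)/H_a(t)) ∫_{ℝ^n} (Δf + ∂_t f)^2 G_a(x,t) dx. -/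
open MeasureTheory Real Set Metric

/-- The spatial Laplacian of `f : ℝⁿ → ℝ`. -/
noncomputable def slap {n : ℕ} (f : EuclideanSpace ℝ (Fin n) → ℝ)
    (x : EuclideanSpace ℝ (Fin n)) : ℝ :=
  ∑ i : Fin n, fderiv ℝ (fun y => fderiv ℝ f y (EuclideanSpace.single i 1)) x
    (EuclideanSpace.single i 1)

/-- The translated Gauss kernel `G_a(x,t) = (t+a)^{-n/2} e^{-|x|²/(4(t+a))}`. -/
noncomputable def gaussKer (n : ℕ) (a : ℝ) (x : EuclideanSpace ℝ (Fin n)) (t : ℝ) : ℝ :=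
  (t + a) ^ (-(n : ℝ) / 2) * Real.exp (-‖x‖ ^ 2 / (4 * (t + a)))

/-- A continuous function of at most polynomial growth. -/
structure ContinuousTemperate {E F : Type*} [NormedAddCommGroup E] [NormedAddCommGroup F]
    (w : E → F) : Prop where
  continuous : Continuous w
  growth : ∃ (k : ℕ) (K : ℝ), ∀ x, ‖w x‖ ≤ K * (1 + ‖x‖) ^ k

namespace ContinuousTemperate

variable {E F G : Type*} [NormedAddCommGroup E] [NormedAddCommGroup F] [NormedAddCommGroup G]

lemma of_bounded {w : E → F} (hw : Continuous w) {K : ℝ} (hK : ∀ x, ‖w x‖ ≤ K) :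
    ContinuousTemperate w :=
  ⟨hw, 0, K, by simpa using hK⟩

lemma const (c : F) : ContinuousTemperate (fun _ : E => c) :=
  of_bounded continuous_const fun _ => le_rfl

lemma id : ContinuousTemperate (fun x : E => x) :=
  ⟨continuous_id, 1, 1, fun x => by simp⟩

lemma of_norm_le_mul {H : Type*} [NormedAddCommGroup H] {u : E → F} {v : E → G} {w : E → H}
    (hw : Continuous w) (hu : ContinuousTemperate u) (hv : ContinuousTemperate v)
    (h : ∀ x, ‖w x‖ ≤ ‖u x‖ * ‖v x‖) : ContinuousTemperate w := by
  obtain ⟨k, K, hK⟩ := hu.growth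
  obtain ⟨l, L, hL⟩ := hv.growth
  refine ⟨hw, k + l, K * L, fun x => (h x).trans ?_⟩
  calc ‖u x‖ * ‖v x‖ ≤ (K * (1 + ‖x‖) ^ k) * (L * (1 + ‖x‖) ^ l) :=
        mul_le_mul (hK x) (hL x) (norm_nonneg _) ((norm_nonneg _).trans (hK x))
    _ = _ := by ring

lemma of_norm_le_add {H : Type*} [NormedAddCommGroup H] {u : E → F} {v : E → G} {w : E → H}
    (hw : Continuous w) (hu : ContinuousTemperate u) (hv : ContinuousTemperate v)
    (h : ∀ x, ‖w x‖ ≤ ‖u x‖ + ‖v x‖) : ContinuousTemperate w := by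
  obtain ⟨k, K, hK⟩ := hu.growth
  obtain ⟨l, L, hL⟩ := hv.growth
  refine ⟨hw, k + l, |K| + |L|, fun x => (h x).trans ?_⟩
  have h1 : (1 : ℝ) ≤ 1 + ‖x‖ := by simp
  calc ‖u x‖ + ‖v x‖ ≤ K * (1 + ‖x‖) ^ k + L * (1 + ‖x‖) ^ l := add_le_add (hK x) (hL x)
    _ ≤ |K| * (1 + ‖x‖) ^ (k + l) + |L| * (1 + ‖x‖) ^ (k + l) := by
        gcongr
        · exact le_abs_self K
        · exact Nat.le_add_right k l
        · exact le_abs_self L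
        · exact Nat.le_add_left l k
    _ = _ := by ring

lemma add {u v : E → F} (hu : ContinuousTemperate u) (hv : ContinuousTemperate v) :
    ContinuousTemperate (fun x => u x + v x) :=
  of_norm_le_add (hu.continuous.add hv.continuous) hu hv fun _ => norm_add_le _ _

lemma sub {u v : E → F} (hu : ContinuousTemperate u) (hv : ContinuousTemperate v) :
    ContinuousTemperate (fun x => u x - v x) :=
  of_norm_le_add (hu.continuous.sub hv.continuous) hu hv fun _ => norm_sub_le _ _

lemma prodMk {u : E → F} {v : E → G} (hu : ContinuousTemperate u) (hv : ContinuousTemperate v) :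
    ContinuousTemperate (fun x => (u x, v x)) :=
  of_norm_le_add (hu.continuous.prodMk hv.continuous) hu hv fun _ =>
    max_le_add_of_nonneg (norm_nonneg _) (norm_nonneg _)

lemma mul {u v : E → ℝ} (hu : ContinuousTemperate u) (hv : ContinuousTemperate v) :
    ContinuousTemperate (fun x => u x * v x) :=
  of_norm_le_mul (hu.continuous.mul hv.continuous) hu hv fun _ => norm_mul_le _ _

lemma sq {u : E → ℝ} (hu : ContinuousTemperate u) : ContinuousTemperate (fun x => u x ^ 2) := by
  simpa only [_root_.sq] using hu.mul hu

lemma smul [NormedSpace ℝ F] {c : E → ℝ} {v : E → F} (hc : ContinuousTemperate c)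
    (hv : ContinuousTemperate v) : ContinuousTemperate (fun x => c x • v x) :=
  of_norm_le_mul (hc.continuous.smul hv.continuous) hc hv fun _ => norm_smul_le _ _

lemma clm_apply [NormedSpace ℝ F] [NormedSpace ℝ G] {A : E → F →L[ℝ] G} {v : E → F}
    (hA : ContinuousTemperate A) (hv : ContinuousTemperate v) :
    ContinuousTemperate (fun x => A x (v x)) :=
  of_norm_le_mul (hA.continuous.clm_apply hv.continuous) hA hv fun x => (A x).le_opNorm (v x)

lemma sum {ι : Type*} (s : Finset ι) {u : ι → E → F} (hu : ∀ i, ContinuousTemperate (u i)) :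
    ContinuousTemperate (fun x => ∑ i ∈ s, u i x) := by
  classical
  induction s using Finset.induction_on with
  | empty => simpa using const (0 : F)
  | insert i s hi ih => simpa only [Finset.sum_insert hi] using (hu i).add ih

lemma integrable_mul_exp_neg_mul_sq [InnerProductSpace ℝ E] [FiniteDimensional ℝ E]
    [MeasurableSpace E] [BorelSpace E] {w : E → ℝ} (hw : ContinuousTemperate w) {b : ℝ}
    (hb : 0 < b) : Integrable (fun x => w x * Real.exp (-b * ‖x‖ ^ 2)) := by
  obtain ⟨k, K, hK⟩ := hw.growth
  have hgauss : Integrable (fun x : E => Real.exp (-(b / 2) * ‖x‖ ^ 2)) := by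
    have h := (GaussianFourier.integrable_cexp_neg_mul_sq_norm_add (V := E)
      (b := ((b / 2 : ℝ) : ℂ)) (by simpa using hb) 0 0).norm
    refine h.congr (Filter.Eventually.of_forall fun x => ?_)
    simp only [Complex.norm_exp]
    congr 1
    simp [← Complex.ofReal_pow]
  refine (hgauss.const_mul (|K| * k.factorial * Real.exp (1 + 1 / (2 * b)))).mono'
    (hw.continuous.mul (by fun_prop)).aestronglyMeasurable
    (Filter.Eventually.of_forall fun x => ?_)
  have hpow : (1 + ‖x‖) ^ k ≤ k.factorial * Real.exp (1 + ‖x‖) := by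
    have h := Real.pow_div_factorial_le_exp (1 + ‖x‖) (by positivity) k
    rwa [div_le_iff₀' (by positivity)] at h
  have hexp : Real.exp (1 + ‖x‖) * Real.exp (-b * ‖x‖ ^ 2)
      ≤ Real.exp (1 + 1 / (2 * b)) * Real.exp (-(b / 2) * ‖x‖ ^ 2) := by
    rw [← Real.exp_add, ← Real.exp_add, Real.exp_le_exp]
    have h : 0 ≤ (b * ‖x‖ - 1) ^ 2 / (2 * b) := by positivity
    have h' : (b * ‖x‖ - 1) ^ 2 / (2 * b) = b / 2 * ‖x‖ ^ 2 - ‖x‖ + 1 / (2 * b) := by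
      field_simp
      ring
    linarith
  rw [norm_mul, Real.norm_of_nonneg (Real.exp_pos _).le]
  calc ‖w x‖ * Real.exp (-b * ‖x‖ ^ 2)
      ≤ (|K| * (k.factorial * Real.exp (1 + ‖x‖))) * Real.exp (-b * ‖x‖ ^ 2) := by
        gcongr
        exact (hK x).trans (mul_le_mul (le_abs_self K) hpow (by positivity) (by positivity))
    _ = |K| * k.factorial * (Real.exp (1 + ‖x‖) * Real.exp (-b * ‖x‖ ^ 2)) := by ring
    _ ≤ |K| * k.factorial *
        (Real.exp (1 + 1 / (2 * b)) * Real.exp (-(b / 2) * ‖x‖ ^ 2)) := by gcongr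
    _ = _ := by ring

end ContinuousTemperate

lemma ContinuousTemperate.integrable_mul_gaussKer {n : ℕ} {w : EuclideanSpace ℝ (Fin n) → ℝ}
    (hw : ContinuousTemperate w) {a t : ℝ} (ht : 0 < t + a) :
    Integrable (fun x => w x * gaussKer n a x t) := by
  have h := (hw.integrable_mul_exp_neg_mul_sq (b := (4 * (t + a))⁻¹) (by positivity)).const_mul
    ((t + a) ^ (-(n : ℝ) / 2))
  refine h.congr (Filter.Eventually.of_forall fun x => ?_)
  simp only [gaussKer]
  rw [show -(4 * (t + a))⁻¹ * ‖x‖ ^ 2 = -‖x‖ ^ 2 / (4 * (t + a)) by ring]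
  ring

lemma gaussKer_nonneg {n : ℕ} {a t : ℝ} (ht : 0 < t + a) (x : EuclideanSpace ℝ (Fin n)) :
    0 ≤ gaussKer n a x t :=
  mul_nonneg (Real.rpow_nonneg ht.le _) (Real.exp_pos _).le

/-- The self-similar change of variables `x = √(t + a) y`. -/
lemma integral_mul_gaussKer_eq {n : ℕ} (w : EuclideanSpace ℝ (Fin n) → ℝ) {a t : ℝ}
    (ht : 0 < t + a) :
    ∫ x, w x * gaussKer n a x t =
      ∫ y, w (√(t + a) • y) * Real.exp (-(1 / 4) * ‖y‖ ^ 2) := by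
  have hs : 0 < √(t + a) := Real.sqrt_pos.2 ht
  have h := Measure.integral_comp_smul_of_nonneg (volume : Measure (EuclideanSpace ℝ (Fin n)))
    (fun x => w x * Real.exp (-‖x‖ ^ 2 / (4 * (t + a)))) (√(t + a)) (hR := hs.le)
  have hpow : (t + a) ^ (-(n : ℝ) / 2) = (√(t + a) ^ n)⁻¹ := by
    rw [← Real.rpow_natCast, Real.sqrt_eq_rpow, ← Real.rpow_mul ht.le, ← Real.rpow_neg ht.le]
    congr 1
    ring
  calc ∫ x, w x * gaussKer n a x t
      = (√(t + a) ^ n)⁻¹ * ∫ x, w x * Real.exp (-‖x‖ ^ 2 / (4 * (t + a))) := by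
        rw [← integral_const_mul]
        congr 1 with x
        rw [gaussKer, hpow]
        ring
    _ = _ := by
        rw [finrank_euclideanSpace_fin, smul_eq_mul] at h
        rw [← h]
        congr 1 with y
        congr 2
        rw [norm_smul, Real.norm_of_nonneg hs.le, mul_pow, Real.sq_sqrt ht.le]
        field_simp

/-- Differentiation in time of a Gaussian average. -/
lemma hasDerivAt_integral_mul_gaussKer {n : ℕ} {a t K : ℝ} (ha : 0 < a) (ht : 0 < t)
    {u : EuclideanSpace ℝ (Fin n) × ℝ → ℝ}
    {u' : EuclideanSpace ℝ (Fin n) × ℝ → EuclideanSpace ℝ (Fin n) × ℝ →L[ℝ] ℝ}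
    (hu : ∀ x s, 0 < s → HasFDerivAt u (u' (x, s)) (x, s))
    (hub : ∀ x s, 0 < s → |u (x, s)| ≤ K) (hub' : ∀ x s, 0 < s → ‖u' (x, s)‖ ≤ K)
    (hc : Continuous fun x => u' (x, t)) :
    HasDerivAt (fun s => ∫ x, u (x, s) * gaussKer n a x s)
      (∫ x, u' (x, t) ((2 * (t + a))⁻¹ • x, 1) * gaussKer n a x t) t := by
  have hcu : ∀ s, 0 < s → Continuous fun x => u (x, s) := fun s hs =>
    continuous_iff_continuousAt.2 fun x =>
      (hu x s hs).continuousAt.comp (f := fun x => (x, s)) (by fun_prop)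
  have hK : 0 ≤ K := (norm_nonneg _).trans (hub' 0 t ht)
  have hexp : Continuous fun y : EuclideanSpace ℝ (Fin n) =>
      Real.exp (-(1 / 4) * ‖y‖ ^ 2) := by fun_prop
  have key := (hasDerivAt_integral_of_dominated_loc_of_deriv_le (μ := volume) (x₀ := t)
    (F := fun s (y : EuclideanSpace ℝ (Fin n)) =>
      u (√(s + a) • y, s) * Real.exp (-(1 / 4) * ‖y‖ ^ 2))
    (F' := fun s y =>
      u' (√(s + a) • y, s) ((2 * √(s + a))⁻¹ • y, 1) * Real.exp (-(1 / 4) * ‖y‖ ^ 2))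
    (bound := fun y => K * ((2 * √a)⁻¹ * ‖y‖ + 1) * Real.exp (-(1 / 4) * ‖y‖ ^ 2))
    (s := Ioi 0) (Ioi_mem_nhds ht) ?_ ?_ ?_ ?_ ?_ ?_).2
  · refine (key.congr_of_eventuallyEq ?_).congr_deriv ?_
    · filter_upwards [Ioi_mem_nhds ht] with s hs
      exact integral_mul_gaussKer_eq (fun x => u (x, s)) (by linarith [mem_Ioi.1 hs])
    · rw [integral_mul_gaussKer_eq _ (by linarith)]
      congr 1 with y
      have hs : 0 < √(t + a) := Real.sqrt_pos.2 (by linarith)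
      have : (2 * √(t + a))⁻¹ = (2 * (t + a))⁻¹ * √(t + a) := by
        nth_rw 2 [← Real.mul_self_sqrt (show 0 ≤ t + a by linarith)]
        field_simp
      rw [smul_smul, this]
  · filter_upwards [Ioi_mem_nhds ht] with s hs
    exact (((hcu s hs).comp (continuous_const_smul _)).mul hexp).aestronglyMeasurable
  · refine (ContinuousTemperate.of_bounded ((hcu t ht).comp (continuous_const_smul (√(t + a))))
      (K := K) fun x => ?_).integrable_mul_exp_neg_mul_sq (by norm_num)
    exact hub _ _ ht
  · refine (Continuous.mul ?_ hexp).aestronglyMeasurable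
    exact (hc.comp (continuous_const_smul (√(t + a)))).clm_apply (by fun_prop)
  · refine Filter.Eventually.of_forall fun y s hs => ?_
    have hs' : 0 < s := hs
    rw [norm_mul, Real.norm_of_nonneg (Real.exp_pos _).le]
    gcongr
    refine (ContinuousLinearMap.le_opNorm _ _).trans ?_
    gcongr
    · exact hub' _ _ hs
    · refine (max_le_add_of_nonneg (norm_nonneg _) (norm_nonneg _)).trans ?_
      simp only [norm_smul, norm_one]
      gcongr
      rw [Real.norm_of_nonneg (by positivity)]
      gcongr
      linarith
  · refine ContinuousTemperate.integrable_mul_exp_neg_mul_sq ?_ (by norm_num)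
    refine (ContinuousTemperate.const K).mul
      (((ContinuousTemperate.const _).mul ?_).add (ContinuousTemperate.const 1))
    exact ⟨continuous_norm, 1, 1, fun x => by simp⟩
  · refine Filter.Eventually.of_forall fun y s hs => ?_
    have hs' : 0 < s := hs
    have hsa : s + a ≠ 0 := by positivity
    have hpath : HasDerivAt (fun r : ℝ => (√(r + a) • y, r)) ((2 * √(s + a))⁻¹ • y, 1) s := by
      refine HasDerivAt.prodMk ?_ (hasDerivAt_id s)
      have := (((hasDerivAt_id s).add_const a).sqrt hsa).smul_const y
      simpa using this
    exact ((hu (√(s + a) • y) s hs).comp_hasDerivAt (f := fun r : ℝ => (√(r + a) • y, r))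
      s hpath).mul_const _

/-- Gaussian integration by parts. -/
lemma integral_lineDeriv_mul_gaussKer {n : ℕ} {a t : ℝ} (ht : 0 < t + a)
    {h h' : EuclideanSpace ℝ (Fin n) → ℝ} {v : EuclideanSpace ℝ (Fin n)}
    (hh : ContinuousTemperate h) (hh' : ContinuousTemperate h')
    (hd : ∀ x, HasLineDerivAt ℝ h (h' x) x v) :
    ∫ x, h' x * gaussKer n a x t =
      ∫ x, h x * ((2 * (t + a))⁻¹ * inner ℝ x v) * gaussKer n a x t := by
  have hin : ContinuousTemperate fun x : EuclideanSpace ℝ (Fin n) => inner ℝ x v :=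
    ContinuousTemperate.of_norm_le_mul (by fun_prop) ContinuousTemperate.id
      (ContinuousTemperate.const v) fun x => norm_inner_le_norm _ _
  have hint : ContinuousTemperate fun x => h x * ((2 * (t + a))⁻¹ * inner ℝ x v) :=
    hh.mul ((ContinuousTemperate.const _).mul hin)
  have hG : ∀ x, HasLineDerivAt ℝ (fun x => gaussKer n a x t)
      (-((2 * (t + a))⁻¹ * inner ℝ x v) * gaussKer n a x t) x v := by
    intro x
    have h1 := ((((hasStrictFDerivAt_norm_sq x).hasFDerivAt.neg.mul_const
      (4 * (t + a))⁻¹).exp.const_mul ((t + a) ^ (-(n : ℝ) / 2))).hasLineDerivAt v)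
    simp only [gaussKer, div_eq_mul_inv] at h1 ⊢
    refine h1.congr_deriv ?_
    simp
    field_simp
    ring
  have := integral_bilinear_hasLineDerivAt_right_eq_neg_left_of_integrable (μ := volume)
    (B := ContinuousLinearMap.mul ℝ ℝ) (f := h) (f' := h') (g := fun x => gaussKer n a x t)
    (v := v) (hh'.integrable_mul_gaussKer ht) ?_ (hh.integrable_mul_gaussKer ht)
    (fun x _ => hd x) (fun x _ => hG x)
  · simp only [ContinuousLinearMap.mul_apply'] at this
    rw [← neg_eq_iff_eq_neg] at this
    rw [← this, ← integral_neg]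
    congr 1 with x
    ring
  · refine (hint.integrable_mul_gaussKer ht).neg.congr (Filter.Eventually.of_forall fun x => ?_)
    simp
    ring

/-- The Cauchy–Schwarz inequality for the Gaussian weight. -/
lemma sq_integral_mul_gaussKer_le {n : ℕ} {a t : ℝ} (ht : 0 < t + a)
    {u v : EuclideanSpace ℝ (Fin n) → ℝ} (hu : ContinuousTemperate u)
    (hv : ContinuousTemperate v) (hpos : 0 < ∫ x, u x ^ 2 * gaussKer n a x t) :
    (∫ x, u x * v x * gaussKer n a x t) ^ 2 ≤
      (∫ x, u x ^ 2 * gaussKer n a x t) * ∫ x, v x ^ 2 * gaussKer n a x t := by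
  set H := ∫ x, u x ^ 2 * gaussKer n a x t
  set c := ∫ x, u x * v x * gaussKer n a x t
  set S := ∫ x, v x ^ 2 * gaussKer n a x t
  have hexpand : ∫ x, (H * v x - c * u x) ^ 2 * gaussKer n a x t =
      H ^ 2 * S - 2 * H * c * c + c ^ 2 * H := by
    have h1 := (hv.sq.integrable_mul_gaussKer ht).const_mul (H ^ 2)
    have h2 := ((hu.mul hv).integrable_mul_gaussKer ht).const_mul (2 * H * c)
    have h3 := (hu.sq.integrable_mul_gaussKer ht).const_mul (c ^ 2)
    have h4 := integral_add (h1.sub h2) h3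
    rw [integral_sub' h1 h2, integral_const_mul, integral_const_mul, integral_const_mul] at h4
    rw [← h4]
    congr 1 with x
    simp only [Pi.sub_apply]
    ring
  have hnonneg : 0 ≤ ∫ x, (H * v x - c * u x) ^ 2 * gaussKer n a x t :=
    integral_nonneg fun x => mul_nonneg (sq_nonneg _) (gaussKer_nonneg ht x)
  rw [hexpand] at hnonneg
  have : 0 ≤ H * (H * S - c ^ 2) := by linarith
  linarith [nonneg_of_mul_nonneg_right this hpos]

/-- A function on the half space `ℝⁿ × (0, ∞)` that is `C²` and bounded together with its first
and second derivatives. -/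
structure IsBoundedC2 {n : ℕ} (f : EuclideanSpace ℝ (Fin n) × ℝ → ℝ) (C : ℝ) : Prop where
  contDiffOn : ContDiffOn ℝ 2 f (univ ×ˢ Ioi (0 : ℝ))
  bound : ∀ p ∈ (univ ×ˢ Ioi (0 : ℝ) : Set (EuclideanSpace ℝ (Fin n) × ℝ)),
      |f p| ≤ C ∧ ‖fderiv ℝ f p‖ ≤ C ∧ ‖iteratedFDeriv ℝ 2 f p‖ ≤ C

/-- The `i`-th spatial basis vector of `ℝⁿ × ℝ`. -/
noncomputable def spatialVec {n : ℕ} (i : Fin n) : EuclideanSpace ℝ (Fin n) × ℝ :=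
  (EuclideanSpace.single i 1, 0)

lemma norm_spatialVec {n : ℕ} (i : Fin n) : ‖spatialVec i‖ = 1 := by
  simp [spatialVec, Prod.norm_def]

/-- The velocity `(x / (2 (t + a)), 1)` of the self-similar flow. -/
noncomputable def selfSimilarVel {n : ℕ} (a t : ℝ) (x : EuclideanSpace ℝ (Fin n)) :
    EuclideanSpace ℝ (Fin n) × ℝ :=
  ((2 * (t + a))⁻¹ • x, 1)

lemma selfSimilarVel_eq {n : ℕ} (a t : ℝ) (x : EuclideanSpace ℝ (Fin n)) :
    selfSimilarVel a t x = (∑ i, ((2 * (t + a))⁻¹ * x i) • spatialVec i) + (0, 1) := by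
  ext j
  · simp [selfSimilarVel, spatialVec, Prod.fst_sum, Finset.sum_apply, Pi.single_apply]
  · simp [selfSimilarVel, spatialVec, Prod.snd_sum]

lemma continuousTemperate_selfSimilarVel {n : ℕ} (a t : ℝ) :
    ContinuousTemperate (selfSimilarVel (n := n) a t) :=
  ((ContinuousTemperate.const _).smul ContinuousTemperate.id).prodMk (ContinuousTemperate.const 1)

namespace IsBoundedC2

variable {n : ℕ} {f : EuclideanSpace ℝ (Fin n) × ℝ → ℝ} {C : ℝ}

lemma mem_halfSpace (x : EuclideanSpace ℝ (Fin n)) {s : ℝ} (hs : 0 < s) :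
    (x, s) ∈ (univ ×ˢ Ioi (0 : ℝ) : Set (EuclideanSpace ℝ (Fin n) × ℝ)) := ⟨mem_univ x, hs⟩

lemma isOpen_halfSpace : IsOpen (univ ×ˢ Ioi (0 : ℝ) : Set (EuclideanSpace ℝ (Fin n) × ℝ)) :=
  isOpen_univ.prod isOpen_Ioi

lemma abs_le (hf : IsBoundedC2 f C) (x : EuclideanSpace ℝ (Fin n)) {s : ℝ} (hs : 0 < s) :
    |f (x, s)| ≤ C := (hf.bound (x, s) (mem_halfSpace x hs)).1

lemma norm_fderiv_le (hf : IsBoundedC2 f C) (x : EuclideanSpace ℝ (Fin n)) {s : ℝ}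
    (hs : 0 < s) : ‖fderiv ℝ f (x, s)‖ ≤ C := (hf.bound (x, s) (mem_halfSpace x hs)).2.1

lemma norm_fderiv_fderiv_le (hf : IsBoundedC2 f C) (x : EuclideanSpace ℝ (Fin n)) {s : ℝ}
    (hs : 0 < s) : ‖fderiv ℝ (fderiv ℝ f) (x, s)‖ ≤ C := by
  have h := (hf.bound (x, s) (mem_halfSpace x hs)).2.2
  rwa [← norm_iteratedFDeriv_fderiv, norm_iteratedFDeriv_one] at h

lemma hasFDerivAt (hf : IsBoundedC2 f C) (x : EuclideanSpace ℝ (Fin n)) {s : ℝ} (hs : 0 < s) :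
    HasFDerivAt f (fderiv ℝ f (x, s)) (x, s) :=
  ((hf.contDiffOn.contDiffAt (isOpen_halfSpace.mem_nhds (mem_halfSpace x hs))).differentiableAt
    (by norm_num)).hasFDerivAt

lemma contDiffOn_fderiv (hf : IsBoundedC2 f C) :
    ContDiffOn ℝ 1 (fderiv ℝ f) (univ ×ˢ Ioi (0 : ℝ)) :=
  hf.contDiffOn.fderiv_of_isOpen isOpen_halfSpace (by norm_num)

lemma hasFDerivAt_fderiv (hf : IsBoundedC2 f C) (x : EuclideanSpace ℝ (Fin n)) {s : ℝ}
    (hs : 0 < s) :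
    HasFDerivAt (fderiv ℝ f) (fderiv ℝ (fderiv ℝ f) (x, s)) (x, s) :=
  ((hf.contDiffOn_fderiv.contDiffAt (isOpen_halfSpace.mem_nhds
    (mem_halfSpace x hs))).differentiableAt (by norm_num)).hasFDerivAt

lemma fderiv_fderiv_symm (hf : IsBoundedC2 f C) (x : EuclideanSpace ℝ (Fin n)) {s : ℝ}
    (hs : 0 < s) (v w : EuclideanSpace ℝ (Fin n) × ℝ) :
    fderiv ℝ (fderiv ℝ f) (x, s) v w = fderiv ℝ (fderiv ℝ f) (x, s) w v :=
  (hf.contDiffOn.contDiffAt (isOpen_halfSpace.mem_nhds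
    (mem_halfSpace x hs))).isSymmSndFDerivAt (by simp) v w

lemma continuousTemperate (hf : IsBoundedC2 f C) {s : ℝ} (hs : 0 < s) :
    ContinuousTemperate fun x => f (x, s) :=
  .of_bounded (hf.contDiffOn.continuousOn.comp_continuous (by fun_prop)
    fun x => mem_halfSpace x hs) fun x => hf.abs_le x hs

lemma continuousTemperate_fderiv (hf : IsBoundedC2 f C) {s : ℝ} (hs : 0 < s) :
    ContinuousTemperate fun x => fderiv ℝ f (x, s) :=
  .of_bounded (hf.contDiffOn_fderiv.continuousOn.comp_continuous (by fun_prop)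
    fun x => mem_halfSpace x hs) fun x => hf.norm_fderiv_le x hs

lemma continuousTemperate_fderiv_fderiv (hf : IsBoundedC2 f C) {s : ℝ} (hs : 0 < s) :
    ContinuousTemperate fun x => fderiv ℝ (fderiv ℝ f) (x, s) :=
  .of_bounded ((hf.contDiffOn_fderiv.continuousOn_fderiv_of_isOpen isOpen_halfSpace
    (by norm_num)).comp_continuous (by fun_prop)
    fun x => mem_halfSpace x hs) fun x => hf.norm_fderiv_fderiv_le x hs

lemma hasFDerivAt_slice (hf : IsBoundedC2 f C) (x : EuclideanSpace ℝ (Fin n)) {s : ℝ}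
    (hs : 0 < s) :
    HasFDerivAt (fun y => f (y, s))
      ((fderiv ℝ f (x, s)).comp (ContinuousLinearMap.inl ℝ _ ℝ)) x :=
  (hf.hasFDerivAt x hs).comp x (hasFDerivAt_prodMk_left x s)

lemma hasFDerivAt_fderiv_slice (hf : IsBoundedC2 f C) (x : EuclideanSpace ℝ (Fin n)) {s : ℝ}
    (hs : 0 < s) :
    HasFDerivAt (fun y => fderiv ℝ f (y, s))
      ((fderiv ℝ (fderiv ℝ f) (x, s)).comp (ContinuousLinearMap.inl ℝ _ ℝ)) x :=
  (hf.hasFDerivAt_fderiv x hs).comp x (hasFDerivAt_prodMk_left x s)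

lemma norm_gradient_sq (hf : IsBoundedC2 f C) (x : EuclideanSpace ℝ (Fin n)) {s : ℝ}
    (hs : 0 < s) :
    ‖gradient (fun y => f (y, s)) x‖ ^ 2 = ∑ i, fderiv ℝ f (x, s) (spatialVec i) ^ 2 := by
  rw [EuclideanSpace.norm_sq_eq]
  refine Finset.sum_congr rfl fun i _ => ?_
  have h : gradient (fun y => f (y, s)) x i = fderiv ℝ f (x, s) (spatialVec i) := by
    have := InnerProductSpace.toDual_symm_apply (𝕜 := ℝ) (x := EuclideanSpace.single i (1 : ℝ))
      (y := fderiv ℝ (fun y => f (y, s)) x)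
    rw [EuclideanSpace.inner_single_right, (hf.hasFDerivAt_slice x hs).fderiv] at this
    simpa [gradient, spatialVec, (hf.hasFDerivAt_slice x hs).fderiv] using this
  rw [h, Real.norm_eq_abs, sq_abs]

lemma slap_add_deriv (hf : IsBoundedC2 f C) (x : EuclideanSpace ℝ (Fin n)) {s : ℝ}
    (hs : 0 < s) :
    slap (fun y => f (y, s)) x + deriv (fun r => f (x, r)) s =
      ∑ i, fderiv ℝ (fderiv ℝ f) (x, s) (spatialVec i) (spatialVec i) +
        fderiv ℝ f (x, s) (0, 1) := by
  congr 1
  · refine Finset.sum_congr rfl fun i _ => ?_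
    have h : (fun y => fderiv ℝ (fun y => f (y, s)) y (EuclideanSpace.single i 1)) =
        fun y => fderiv ℝ f (y, s) (spatialVec i) := by
      ext y
      simp [(hf.hasFDerivAt_slice y hs).fderiv, spatialVec]
    have h' : HasFDerivAt (fun y => fderiv ℝ f (y, s) (spatialVec i)) _ x :=
      (hf.hasFDerivAt_fderiv_slice x hs).clm_apply
        (hasFDerivAt_const (spatialVec i) x)
    rw [h, h'.fderiv]
    simp [spatialVec]
  · have h : HasDerivAt (fun r : ℝ => (x, r)) ((0 : EuclideanSpace ℝ (Fin n)), (1 : ℝ)) s :=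
      (hasDerivAt_const s x).prodMk (hasDerivAt_id s)
    exact ((hf.hasFDerivAt x hs).comp_hasDerivAt s h).deriv

lemma hasDerivAt_integral_sq (hf : IsBoundedC2 f C) {a t : ℝ} (ha : 0 < a) (ht : 0 < t) :
    HasDerivAt (fun s => ∫ x, f (x, s) ^ 2 * gaussKer n a x s)
      (2 * ∫ x, f (x, t) * fderiv ℝ f (x, t) (selfSimilarVel a t x) * gaussKer n a x t) t := by
  have hC : 0 ≤ C := (abs_nonneg _).trans (hf.abs_le 0 ht)
  refine (hasDerivAt_integral_mul_gaussKer (n := n) (K := 2 * C ^ 2)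
    (u := fun p => f p ^ 2) (u' := fun p => (2 * f p) • fderiv ℝ f p) ha ht
    ?_ ?_ ?_ ?_).congr_deriv ?_
  · intro x s hs
    simpa using (hf.hasFDerivAt x hs).pow 2
  · intro x s hs
    have := pow_le_pow_left₀ (abs_nonneg _) (hf.abs_le x hs) 2
    rw [abs_pow]
    nlinarith
  · intro x s hs
    rw [norm_smul, norm_mul, Real.norm_ofNat, pow_two, mul_assoc]
    gcongr
    · exact hf.abs_le x hs
    · exact hf.norm_fderiv_le x hs
  · exact ((ContinuousTemperate.const 2).mul (hf.continuousTemperate ht)).smul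
      (hf.continuousTemperate_fderiv ht) |>.continuous
  · rw [← integral_const_mul]
    congr 1 with x
    simp [selfSimilarVel]
    ring

lemma hasDerivAt_integral_fderiv_sq (hf : IsBoundedC2 f C) {a t : ℝ} (ha : 0 < a)
    (ht : 0 < t) :
    HasDerivAt (fun s => ∫ x, (∑ i, fderiv ℝ f (x, s) (spatialVec i) ^ 2) * gaussKer n a x s)
      (2 * ∫ x, (∑ i, fderiv ℝ f (x, t) (spatialVec i) *
        fderiv ℝ (fderiv ℝ f) (x, t) (spatialVec i) (selfSimilarVel a t x)) *
          gaussKer n a x t) t := by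
  have hC : 0 ≤ C := (abs_nonneg _).trans (hf.abs_le 0 ht)
  have hg : ∀ (i : Fin n) x s, 0 < s → ‖fderiv ℝ f (x, s) (spatialVec i)‖ ≤ C := by
    intro i x s hs
    simpa [norm_spatialVec] using
      (fderiv ℝ f (x, s)).le_of_opNorm_le (hf.norm_fderiv_le x hs) (spatialVec i)
  refine (hasDerivAt_integral_mul_gaussKer (n := n) (K := ∑ _ : Fin n, 2 * C ^ 2)
    (u := fun p => ∑ i, fderiv ℝ f p (spatialVec i) ^ 2)
    (u' := fun p => ∑ i, (2 * fderiv ℝ f p (spatialVec i)) •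
      (fderiv ℝ (fderiv ℝ f) p).flip (spatialVec i)) ha ht
    ?_ ?_ ?_ ?_).congr_deriv ?_
  · intro x s hs
    refine HasFDerivAt.fun_sum fun i _ => ?_
    have := ((hf.hasFDerivAt_fderiv x hs).clm_apply
      (hasFDerivAt_const (spatialVec i) (x, s))).pow 2
    simpa using this
  · intro x s hs
    refine (Finset.abs_sum_le_sum_abs _ _).trans (Finset.sum_le_sum fun i _ => ?_)
    have := pow_le_pow_left₀ (abs_nonneg _) (hg i x s hs) 2
    rw [abs_pow]
    rw [Real.norm_eq_abs] at this
    nlinarith [sq_nonneg C]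
  · intro x s hs
    refine (norm_sum_le _ _).trans (Finset.sum_le_sum fun i _ => ?_)
    rw [norm_smul, norm_mul, Real.norm_ofNat, pow_two, mul_assoc]
    gcongr
    · exact hg i x s hs
    · have := (fderiv ℝ (fderiv ℝ f) (x, s)).flip.le_opNorm (spatialVec i)
      rw [norm_spatialVec, mul_one, ContinuousLinearMap.opNorm_flip] at this
      exact this.trans (hf.norm_fderiv_fderiv_le x hs)
  · have h1 := (hf.continuousTemperate_fderiv ht).continuous
    have h2 := (ContinuousLinearMap.flipₗᵢ ℝ (EuclideanSpace ℝ (Fin n) × ℝ)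
      (EuclideanSpace ℝ (Fin n) × ℝ) ℝ).continuous.comp
      (hf.continuousTemperate_fderiv_fderiv ht).continuous
    refine continuous_finsetSum _ fun i _ => ?_
    exact (continuous_const.mul (h1.clm_apply continuous_const)).smul
      (h2.clm_apply continuous_const)
  · rw [← integral_const_mul]
    congr 1 with x
    simp only [_root_.sum_apply, _root_.smul_apply,
      ContinuousLinearMap.flip_apply, smul_eq_mul, Finset.sum_mul, Finset.mul_sum]
    refine Finset.sum_congr rfl fun i _ => ?_
    rw [hf.fderiv_fderiv_symm x ht (spatialVec i), selfSimilarVel]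
    ring

/-- Gaussian integration by parts for the vector field `h ∇f`. -/
lemma integral_div_mul_gradient (hf : IsBoundedC2 f C) {a t : ℝ} (ha : 0 < a) (ht : 0 < t)
    {h : EuclideanSpace ℝ (Fin n) → ℝ} {h' : Fin n → EuclideanSpace ℝ (Fin n) → ℝ}
    (hh : ContinuousTemperate h) (hh' : ∀ i, ContinuousTemperate (h' i))
    (hd : ∀ i x, HasLineDerivAt ℝ h (h' i x) x (EuclideanSpace.single i 1)) :
    ∫ x, (∑ i, h' i x * fderiv ℝ f (x, t) (spatialVec i)) * gaussKer n a x t =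
      ∫ x, h x * (fderiv ℝ f (x, t) (selfSimilarVel a t x) -
        (slap (fun y => f (y, t)) x + deriv (fun s => f (x, s)) t)) * gaussKer n a x t := by
  have hτ : 0 < t + a := by linarith
  have hg : ∀ i : Fin n, ContinuousTemperate fun x => fderiv ℝ f (x, t) (spatialVec i) :=
    fun i => (hf.continuousTemperate_fderiv ht).clm_apply (.const _)
  have hM : ∀ i : Fin n, ContinuousTemperate fun x =>
      fderiv ℝ (fderiv ℝ f) (x, t) (spatialVec i) (spatialVec i) :=
    fun i => ((hf.continuousTemperate_fderiv_fderiv ht).clm_apply (.const _)).clm_apply (.const _)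
  have hx : ∀ i : Fin n, ContinuousTemperate fun x : EuclideanSpace ℝ (Fin n) =>
      inner ℝ x (EuclideanSpace.single i 1) := fun i =>
    .of_norm_le_mul (by fun_prop) .id (.const (EuclideanSpace.single i (1 : ℝ)))
      fun x => norm_inner_le_norm _ _
  have hparts := fun i => integral_lineDeriv_mul_gaussKer (a := a) (t := t) hτ (hh.mul (hg i))
    (((hh' i).mul (hg i)).add (hh.mul (hM i))) (v := EuclideanSpace.single i 1) fun x => by
      have := ((hf.hasFDerivAt_fderiv_slice x ht).clm_apply
        (hasFDerivAt_const (spatialVec i) x)).hasLineDerivAt (EuclideanSpace.single i 1)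
      have h2 := HasDerivAt.fun_mul (hd i x) this
      refine h2.congr_deriv ?_
      simp [spatialVec]
  have hsum := Finset.sum_congr (rfl : (Finset.univ : Finset (Fin n)) = _) fun i _ => hparts i
  have i1 := fun i => (((hh' i).mul (hg i)).add (hh.mul (hM i))).integrable_mul_gaussKer
    (a := a) (t := t) hτ
  have i2 := fun i => ((hh.mul (hg i)).mul
    ((ContinuousTemperate.const (2 * (t + a))⁻¹).mul (hx i))).integrable_mul_gaussKer
    (a := a) (t := t) hτ
  have i3 := (hh.mul (ContinuousTemperate.sum Finset.univ hM)).integrable_mul_gaussKer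
    (a := a) (t := t) hτ
  rw [← integral_finsetSum _ fun i _ => i1 i, ← integral_finsetSum _ fun i _ => i2 i] at hsum
  have hsub := congrArg (fun z => z - ∫ x, (h x * ∑ i : Fin n,
    fderiv ℝ (fderiv ℝ f) (x, t) (spatialVec i) (spatialVec i)) * gaussKer n a x t) hsum
  rw [← integral_sub (integrable_finsetSum _ fun i _ => i1 i) i3,
    ← integral_sub (integrable_finsetSum _ fun i _ => i2 i) i3] at hsub
  convert hsub using 3 with x x
  · simp only [add_mul, Finset.sum_add_distrib, Finset.mul_sum, Finset.sum_mul]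
    ring
  · rw [hf.slap_add_deriv x ht, selfSimilarVel_eq]
    simp only [map_add, map_sum, map_smul, smul_eq_mul, EuclideanSpace.inner_single_right]
    simp only [mul_sub, mul_add, sub_mul, add_mul, Finset.mul_sum, Finset.sum_mul]
    rw [show ∀ A B D : ℝ, A + D - (B + D) = A - B by intros; ring]
    congr 1
    refine Finset.sum_congr rfl fun i _ => ?_
    rw [conj_trivial]
    ring

lemma integral_fderiv_sq_eq (hf : IsBoundedC2 f C) {a t : ℝ} (ha : 0 < a) (ht : 0 < t) :
    ∫ x, (∑ i, fderiv ℝ f (x, t) (spatialVec i) ^ 2) * gaussKer n a x t =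
      ∫ x, f (x, t) * (fderiv ℝ f (x, t) (selfSimilarVel a t x) -
        (slap (fun y => f (y, t)) x + deriv (fun s => f (x, s)) t)) * gaussKer n a x t := by
  rw [← hf.integral_div_mul_gradient ha ht (hf.continuousTemperate ht)
    (h' := fun i x => fderiv ℝ f (x, t) (spatialVec i))
    (fun i => (hf.continuousTemperate_fderiv ht).clm_apply (.const _))
    fun i x => by
      simpa [spatialVec] using (hf.hasFDerivAt_slice x ht).hasLineDerivAt
        (EuclideanSpace.single i 1)]
  simp only [_root_.sq]

lemma integral_fderiv_mul_fderiv_fderiv_eq (hf : IsBoundedC2 f C) {a t : ℝ} (ha : 0 < a)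
    (ht : 0 < t) :
    ∫ x, (∑ i, fderiv ℝ f (x, t) (spatialVec i) *
        fderiv ℝ (fderiv ℝ f) (x, t) (spatialVec i) (selfSimilarVel a t x)) *
          gaussKer n a x t =
      (∫ x, fderiv ℝ f (x, t) (selfSimilarVel a t x) *
        (fderiv ℝ f (x, t) (selfSimilarVel a t x) -
        (slap (fun y => f (y, t)) x + deriv (fun s => f (x, s)) t)) * gaussKer n a x t) -
      (2 * (t + a))⁻¹ *
        ∫ x, (∑ i, fderiv ℝ f (x, t) (spatialVec i) ^ 2) * gaussKer n a x t := by
  have hτ : 0 < t + a := by linarith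
  have hV := continuousTemperate_selfSimilarVel (n := n) a t
  have hL := hf.continuousTemperate_fderiv ht
  have hM := hf.continuousTemperate_fderiv_fderiv ht
  have hg : ∀ i : Fin n, ContinuousTemperate fun x => fderiv ℝ f (x, t) (spatialVec i) :=
    fun i => hL.clm_apply (.const _)
  have hMV : ∀ i : Fin n, ContinuousTemperate fun x =>
      fderiv ℝ (fderiv ℝ f) (x, t) (spatialVec i) (selfSimilarVel a t x) :=
    fun i => (hM.clm_apply (.const _)).clm_apply hV
  rw [← hf.integral_div_mul_gradient ha ht (hL.clm_apply hV)
    (h' := fun i x => fderiv ℝ (fderiv ℝ f) (x, t) (spatialVec i) (selfSimilarVel a t x) +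
      (2 * (t + a))⁻¹ * fderiv ℝ f (x, t) (spatialVec i))
    (fun i => (hMV i).add ((ContinuousTemperate.const _).mul (hg i))) ?_]
  · have i1 := (ContinuousTemperate.sum Finset.univ fun i =>
      (((hMV i).add ((ContinuousTemperate.const (2 * (t + a))⁻¹).mul (hg i))).mul
        (hg i))).integrable_mul_gaussKer (a := a) (t := t) hτ
    have i2 := (ContinuousTemperate.sum Finset.univ fun i =>
      (hg i).sq).integrable_mul_gaussKer (a := a) (t := t) hτ
    rw [← integral_const_mul, ← integral_sub i1 (i2.const_mul _)]
    congr 1 with x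
    rw [← mul_assoc, ← sub_mul, Finset.mul_sum, ← Finset.sum_sub_distrib]
    congr 1
    refine Finset.sum_congr rfl fun i _ => ?_
    ring
  · intro i x
    have hvel : HasFDerivAt (selfSimilarVel (n := n) a t)
        (((2 * (t + a))⁻¹ • ContinuousLinearMap.id ℝ _).prod 0) x :=
      ((hasFDerivAt_id x).const_smul (2 * (t + a))⁻¹).prodMk (hasFDerivAt_const 1 x)
    have h := ((hf.hasFDerivAt_fderiv_slice x ht).clm_apply
      hvel).hasLineDerivAt (EuclideanSpace.single i 1)
    refine HasDerivAt.congr_deriv h ?_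
    have hs : ((2 * (t + a))⁻¹ • EuclideanSpace.single i (1 : ℝ), (0 : ℝ)) =
        (2 * (t + a))⁻¹ • spatialVec i := by simp [spatialVec]
    simp only [_root_.add_apply, ContinuousLinearMap.comp_apply,
      ContinuousLinearMap.flip_apply, ContinuousLinearMap.prod_apply,
      _root_.smul_apply, ContinuousLinearMap.id_apply,
      _root_.zero_apply, ContinuousLinearMap.inl_apply]
    rw [hs, map_smul, smul_eq_mul, add_comm]
    rfl

end IsBoundedC2

lemma neg_div_mul_le_quotient_deriv {τ H D S p Φ : ℝ} (hτ : 0 < τ) (hH : 0 < H)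
    (hCS : (1 / 2 * p + 1 / 2 * D) ^ 2 ≤ H * S) :
    -(τ / H) * Φ ≤ ((2 * 1 * D + 2 * τ * (2 * (S - 1 / 4 * Φ - (2 * τ)⁻¹ * D))) * H -
      2 * τ * D * (2 * p)) / H ^ 2 := by
  have h : 0 ≤ τ * (H * S - D * p) := mul_nonneg hτ.le (by nlinarith [sq_nonneg (p - D)])
  have e1 : -(τ / H) * Φ * H ^ 2 = -(τ * Φ * H) := by field_simp
  have e2 : 2 * τ * (2 * (S - 1 / 4 * Φ - (2 * τ)⁻¹ * D)) = 4 * τ * S - τ * Φ - 2 * D := by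
    field_simp
    ring
  rw [le_div_iff₀ (by positivity), e1, e2]
  linarith

/-- frequency function: if `a > 0` and `f ∈ W^{2,∞}(ℝⁿ × (0,∞))`
(formalized as: `f` is `C²` on `ℝⁿ × (0,∞)` and `f` together with its first and second
order derivatives is bounded there), then with `H_a(t) = ∫ f² G_a dx`,
`D_a(t) = ∫ |∇f|² G_a dx` and `N_a(t) = 2(t+a)D_a(t)/H_a(t)`, at every `t > 0` where
`H_a(t) > 0` the frequency function `N_a` has a derivative `d` with
`d ≥ −((t+a)/H_a(t)) ∫ (Δf + ∂ₜf)² G_a dx`. -/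
theorem stmt_17 (n : ℕ) (a : ℝ) (ha : 0 < a)
    (f : EuclideanSpace ℝ (Fin n) × ℝ → ℝ)
    (hreg : ContDiffOn ℝ 2 f (univ ×ˢ Ioi (0 : ℝ)))
    (hbdd : ∃ C : ℝ, ∀ p ∈ (univ ×ˢ Ioi (0 : ℝ) :
        Set (EuclideanSpace ℝ (Fin n) × ℝ)),
      |f p| ≤ C ∧ ‖fderiv ℝ f p‖ ≤ C ∧ ‖iteratedFDeriv ℝ 2 f p‖ ≤ C) :
    ∀ t : ℝ, 0 < t →
      0 < (∫ x : EuclideanSpace ℝ (Fin n), f (x, t) ^ 2 * gaussKer n a x t) →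
      ∃ d : ℝ,
        HasDerivAt (fun s : ℝ =>
          2 * (s + a) *
              (∫ x : EuclideanSpace ℝ (Fin n),
                ‖gradient (fun y => f (y, s)) x‖ ^ 2 * gaussKer n a x s) /
            (∫ x : EuclideanSpace ℝ (Fin n), f (x, s) ^ 2 * gaussKer n a x s)) d t ∧
        d ≥ -((t + a) /
              (∫ x : EuclideanSpace ℝ (Fin n), f (x, t) ^ 2 * gaussKer n a x t)) *
            (∫ x : EuclideanSpace ℝ (Fin n),
              (slap (fun y => f (y, t)) x + deriv (fun s => f (x, s)) t) ^ 2 *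
                gaussKer n a x t) := by
  intro t ht hH
  obtain ⟨C, hC⟩ := hbdd
  have hf : IsBoundedC2 f C := ⟨hreg, hC⟩
  have hτ : 0 < t + a := by linarith
  have hP := (hf.continuousTemperate_fderiv ht).clm_apply
    (continuousTemperate_selfSimilarVel (n := n) a t)
  have hF : ContinuousTemperate fun x =>
      slap (fun y => f (y, t)) x + deriv (fun s => f (x, s)) t := by
    simp only [hf.slap_add_deriv _ ht]
    exact (ContinuousTemperate.sum Finset.univ fun i =>
      ((hf.continuousTemperate_fderiv_fderiv ht).clm_apply (.const _)).clm_apply (.const _)).add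
      ((hf.continuousTemperate_fderiv ht).clm_apply (.const _))
  have hH' := hf.hasDerivAt_integral_sq ha ht
  have hD' := hf.hasDerivAt_integral_fderiv_sq ha ht
  rw [hf.integral_fderiv_mul_fderiv_fderiv_eq ha ht] at hD'
  have hD := hf.integral_fderiv_sq_eq ha ht
  set P : EuclideanSpace ℝ (Fin n) → ℝ := fun x => fderiv ℝ f (x, t) (selfSimilarVel a t x)
  set F : EuclideanSpace ℝ (Fin n) → ℝ := fun x =>
    slap (fun y => f (y, t)) x + deriv (fun s => f (x, s)) t
  have hQ : ContinuousTemperate fun x => P x - 1 / 2 * F x :=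
    hP.sub ((ContinuousTemperate.const _).mul hF)
  have hCS := sq_integral_mul_gaussKer_le hτ (hf.continuousTemperate ht) hQ hH
  have hfQ : ∫ x, f (x, t) * (P x - 1 / 2 * F x) * gaussKer n a x t =
      1 / 2 * (∫ x, f (x, t) * P x * gaussKer n a x t) +
        1 / 2 * ∫ x, f (x, t) * (P x - F x) * gaussKer n a x t := by
    rw [← integral_const_mul, ← integral_const_mul, ← integral_add
      ((((hf.continuousTemperate ht).mul hP).integrable_mul_gaussKer hτ).const_mul _)
      ((((hf.continuousTemperate ht).mul (hP.sub hF)).integrable_mul_gaussKer hτ).const_mul _)]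
    congr 1 with x
    ring
  have hPF : ∫ x, P x * (P x - F x) * gaussKer n a x t =
      (∫ x, (P x - 1 / 2 * F x) ^ 2 * gaussKer n a x t) -
        1 / 4 * ∫ x, F x ^ 2 * gaussKer n a x t := by
    rw [← integral_const_mul, ← integral_sub (hQ.sq.integrable_mul_gaussKer hτ)
      ((hF.sq.integrable_mul_gaussKer hτ).const_mul _)]
    congr 1 with x
    ring
  change HasDerivAt _ (2 * ((∫ x, P x * (P x - F x) * gaussKer n a x t) - _)) t at hD'
  rw [hPF] at hD'
  have hN := (((((hasDerivAt_id t).add_const a).const_mul 2).mul hD').div hH' hH.ne')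
  refine ⟨_, hN.congr_of_eventuallyEq ?_, ?_⟩
  · filter_upwards [Ioi_mem_nhds ht] with s hs
    simp only [hf.norm_gradient_sq _ hs]
    rfl
  · rw [hfQ, ← hD] at hCS
    exact neg_div_mul_le_quotient_deriv hτ hH hCS
end

section
/- Let a > 0 and let f ∈ W^{2,∞}(ℝ^{n+1}_+) have compact support in the space variable. Define H_a(t) = ∫_{ℝ^n} f(x,t)^2 G_a(x,t) dx and D_a(t) = ∫_{ℝ^n} |∇f(x,t)|^2 G_a(x,t) dx. Then for every t > 0 one has the identities: Ḣ_a(t) = 2 ∫_{ℝ^n} f (Δf + ∂_t f) G_a dx + 2 D_a(t), and Ḋ_a(t) = 2 ∫_{ℝ^n} ( ∂_t f + (x/(2(t+a))) · ∇f − (1/2)(Δf + ∂_t f) )^2 G_a dx − (1/2) ∫_{ℝ^n} (Δf + ∂_t f)^2 G_a dx − D_a(t)/(t+a). -/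
open MeasureTheory Real Set Metric
open scoped RealInnerProductSpace

/-- The integral of a directional derivative of a compactly supported function vanishes. -/
lemma integral_eq_zero_of_hasLineDerivAt {E : Type*} [NormedAddCommGroup E] [NormedSpace ℝ E]
    [FiniteDimensional ℝ E] [MeasurableSpace E] [BorelSpace E] {μ : Measure E}
    [μ.IsAddHaarMeasure] {V V' : E → ℝ} {v : E} {K : Set E}
    (hK : IsCompact K) (hV : Continuous V) (hV' : Continuous V') (h0 : ∀ x, x ∉ K → V x = 0)
    (h : ∀ x, HasLineDerivAt ℝ V (V' x) x v) :
    Integrable V' μ ∧ ∫ x, V' x ∂μ = 0 := by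
  have h0' : ∀ x, x ∉ K → V' x = 0 := fun x hx => by
    have hev : ∀ᶠ y in nhds x, V y = 0 :=
      Filter.mem_of_superset (hK.isClosed.isOpen_compl.mem_nhds hx) h0
    have h1 := h x
    have hc : ContinuousAt (fun r : ℝ => x + r • v) 0 := by fun_prop
    have h2 : HasDerivAt (fun r : ℝ => V (x + r • v)) 0 0 :=
      (hasDerivAt_const (0 : ℝ) (0 : ℝ)).congr_of_eventuallyEq
        (hc.eventually (p := fun y => V y = 0) (by simpa using hev))
    exact HasDerivAt.unique h1 h2
  have iV : Integrable V μ := hV.integrable_of_hasCompactSupport (HasCompactSupport.intro hK h0)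
  have iV' : Integrable V' μ :=
    hV'.integrable_of_hasCompactSupport (HasCompactSupport.intro hK h0')
  refine ⟨iV', ?_⟩
  have := integral_bilinear_hasLineDerivAt_right_eq_neg_left_of_integrable (μ := μ)
    (f := fun _ : E => (1 : ℝ)) (f' := fun _ => 0) (g := V) (g' := V') (v := v)
    (B := ContinuousLinearMap.mul ℝ ℝ) (by simp) (by simpa using iV') (by simpa using iV)
    (fun x _ => by simpa [HasLineDerivAt] using hasDerivAt_const (0 : ℝ) (1 : ℝ)) fun x _ => h x
  simpa using this

/-- Differentiation under the integral sign for families supported in a fixed compact set. -/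
lemma hasDerivAt_integral_of_compact_support {E : Type*} [NormedAddCommGroup E]
    [MeasurableSpace E] [BorelSpace E] {μ : Measure E}
    [IsFiniteMeasureOnCompacts μ] {K : Set E} (hK : IsCompact K) {Φ Φ' : E → ℝ → ℝ}
    (hΦ : ∀ s, 0 < s → Continuous fun x => Φ x s)
    (hΦ' : ContinuousOn (fun p : E × ℝ => Φ' p.1 p.2) (univ ×ˢ Ioi 0))
    (h0 : ∀ x s, 0 < s → x ∉ K → Φ x s = 0)
    (hd : ∀ x s, 0 < s → HasDerivAt (Φ x) (Φ' x s) s) {t : ℝ} (ht : 0 < t) :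
    HasDerivAt (fun s => ∫ x, Φ x s ∂μ) (∫ x, Φ' x t ∂μ) t := by
  have h0' : ∀ x s, 0 < s → x ∉ K → Φ' x s = 0 := fun x s hs hx =>
    (hd x s hs).unique ((hasDerivAt_const s (0 : ℝ)).congr_of_eventuallyEq
      (Filter.mem_of_superset (Ioi_mem_nhds hs) fun r hr => h0 x r hr hx))
  have hΦi : ∀ s, 0 < s → Integrable (fun x => Φ x s) μ := fun s hs =>
    (hΦ s hs).integrable_of_hasCompactSupport (HasCompactSupport.intro hK fun x => h0 x s hs)
  have hΦ'c : Continuous fun x => Φ' x t := by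
    rw [← continuousOn_univ]
    exact hΦ'.comp (f := fun x : E => (x, t)) (by fun_prop) fun x _ => ⟨mem_univ _, ht⟩
  have hIcc : Icc (t / 2) (2 * t) ⊆ Ioi 0 := fun s hs => lt_of_lt_of_le (by positivity) hs.1
  obtain ⟨C, hC⟩ := (hK.prod (isCompact_Icc (a := t / 2) (b := 2 * t))).exists_bound_of_continuousOn
    (hΦ'.mono (prod_mono (subset_univ K) hIcc))
  refine (hasDerivAt_integral_of_dominated_loc_of_deriv_le (F := fun s x => Φ x s)
    (F' := fun s x => Φ' x s) (bound := K.indicator fun _ => C)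
    (Icc_mem_nhds (a := t / 2) (b := 2 * t) (by linarith) (by linarith)) ?_ (hΦi t ht)
    (hΦ'c.integrable_of_hasCompactSupport
      (HasCompactSupport.intro hK fun x => h0' x t ht)).aestronglyMeasurable ?_ ?_ ?_).2
  · exact Filter.mem_of_superset (Ioi_mem_nhds ht) fun s hs => (hΦi s hs).aestronglyMeasurable
  · refine Filter.Eventually.of_forall fun x s hs => ?_
    by_cases hx : x ∈ K
    · simpa [hx] using hC (x, s) ⟨hx, hs⟩
    · simp [hx, h0' x s (hIcc hs) hx]
  · exact (integrable_indicator_iff hK.measurableSet).2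
      (integrableOn_const hK.measure_lt_top.ne)
  · exact Filter.Eventually.of_forall fun x s hs => hd x s (hIcc hs)

lemma hasLineDerivAt_coord {n : ℕ} (i j : Fin n) (x : EuclideanSpace ℝ (Fin n)) :
    HasLineDerivAt ℝ (fun y : EuclideanSpace ℝ (Fin n) => y j) (if j = i then 1 else 0) x
      (EuclideanSpace.single i 1) := by
  unfold HasLineDerivAt
  have := ((hasDerivAt_id (0 : ℝ)).mul_const (if j = i then (1 : ℝ) else 0)).const_add (x j)
  simpa [Pi.single_apply] using this

lemma continuous_gaussKer (n : ℕ) (a t : ℝ) : Continuous fun x => gaussKer n a x t := by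
  unfold gaussKer
  fun_prop

lemma hasLineDerivAt_gaussKer {n : ℕ} {a t : ℝ} (ht : 0 < t + a) (i : Fin n) (x : EuclideanSpace ℝ (Fin n)) :
    HasLineDerivAt ℝ (fun y => gaussKer n a y t) (-(x i / (2 * (t + a))) * gaussKer n a x t) x
      (EuclideanSpace.single i 1) := by
  have h := ((hasDerivAt_id (0 : ℝ)).smul_const
    (EuclideanSpace.single i (1 : ℝ))).const_add x |>.norm_sq
  have h' := ((h.neg.div_const (4 * (t + a))).exp).const_mul ((t + a) ^ (-(n : ℝ) / 2))
  refine HasDerivAt.congr_deriv h' ?_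
  unfold gaussKer
  simp [EuclideanSpace.inner_single_right]
  field_simp
  ring

lemma hasDerivAt_gaussKer {n : ℕ} {a t : ℝ} (h : 0 < t + a) (x : EuclideanSpace ℝ (Fin n)) :
    HasDerivAt (gaussKer n a x)
      ((‖x‖ ^ 2 / (4 * (t + a) ^ 2) - n / (2 * (t + a))) * gaussKer n a x t) t := by
  have h1 : HasDerivAt (fun s : ℝ => s + a) 1 t := (hasDerivAt_id t).add_const a
  have h2 := h1.rpow_const (p := -(n : ℝ) / 2) (Or.inl h.ne')
  have h3 := ((hasDerivAt_const t (-‖x‖ ^ 2)).fun_div (h1.const_mul 4) (by positivity : 4 * (t + a) ≠ 0)).exp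
  have h4 := h2.fun_mul h3
  refine h4.congr_deriv ?_
  unfold gaussKer
  rw [Real.rpow_sub_one h.ne']
  field_simp
  ring

section IntegrationByParts

variable {n : ℕ} {K : Set (EuclideanSpace ℝ (Fin n))} {u w : EuclideanSpace ℝ (Fin n) → ℝ}
  {p r : Fin n → EuclideanSpace ℝ (Fin n) → ℝ}
  {q : Fin n → Fin n → EuclideanSpace ℝ (Fin n) → ℝ}

lemma integral_sq_mul_heat_gaussKer (hK : IsCompact K)
    (hu : Continuous u) (hw : Continuous w) (hp : ∀ i, Continuous (p i))
    (hq : ∀ i j, Continuous (q i j))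
    (hu0 : ∀ x, x ∉ K → u x = 0) (hp0 : ∀ i x, x ∉ K → p i x = 0)
    (hup : ∀ i x, HasLineDerivAt ℝ u (p i x) x (EuclideanSpace.single i 1))
    (hpq : ∀ i j x, HasLineDerivAt ℝ (p j) (q i j x) x (EuclideanSpace.single i 1))
    {a t : ℝ} (hta : 0 < t + a) :
    ∫ x, (2 * u x * w x + u x ^ 2 * (‖x‖ ^ 2 / (4 * (t + a) ^ 2) - n / (2 * (t + a))))
        * gaussKer n a x t =
      2 * (∫ x, u x * ((∑ i, q i i x) + w x) * gaussKer n a x t) +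
      2 * (∫ x, (∑ i, p i x ^ 2) * gaussKer n a x t) := by
  have hG := continuous_gaussKer n a t
  have key : ∀ i, Integrable (fun x => (-(2 * u x * p i x * (x i / (2 * (t + a))))
        - u x ^ 2 / (2 * (t + a)) - 2 * p i x ^ 2 - 2 * u x * q i i x
        + (u x ^ 2 * (x i / (2 * (t + a))) + 2 * u x * p i x) * (x i / (2 * (t + a))))
        * gaussKer n a x t) ∧ ∫ x, (-(2 * u x * p i x * (x i / (2 * (t + a))))
        - u x ^ 2 / (2 * (t + a)) - 2 * p i x ^ 2 - 2 * u x * q i i x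
        + (u x ^ 2 * (x i / (2 * (t + a))) + 2 * u x * p i x) * (x i / (2 * (t + a))))
        * gaussKer n a x t = 0 := fun i => by
    refine integral_eq_zero_of_hasLineDerivAt (v := EuclideanSpace.single i 1) (V := fun x =>
      -(u x ^ 2 * (x i / (2 * (t + a))) + 2 * u x * p i x) * gaussKer n a x t) hK
      (by fun_prop) (by fun_prop) (fun x hx => by simp [hu0 x hx]) fun x => ?_
    have hU := hup i x
    have hP := hpq i i x
    have hX := hasLineDerivAt_coord i i x
    have hGd := hasLineDerivAt_gaussKer hta i x
    unfold HasLineDerivAt at *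
    have := (((hU.fun_pow 2).fun_mul (hX.div_const (2 * (t + a)))).fun_add
      ((hU.const_mul 2).fun_mul hP)).fun_neg.fun_mul hGd
    refine this.congr_deriv ?_
    simp
    field_simp
    ring
  have hI1 : Integrable fun x => u x * ((∑ i, q i i x) + w x) * gaussKer n a x t :=
    Continuous.integrable_of_hasCompactSupport (by fun_prop)
      (HasCompactSupport.intro hK fun x hx => by simp [hu0 x hx])
  have hI2 : Integrable fun x => (∑ i, p i x ^ 2) * gaussKer n a x t :=
    Continuous.integrable_of_hasCompactSupport (by fun_prop)
      (HasCompactSupport.intro hK fun x hx => by simp [hp0 _ x hx])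
  have hsum := integral_finsetSum Finset.univ fun i _ => (key i).1
  have hIs := integrable_finsetSum Finset.univ fun i _ => (key i).1
  rw [Finset.sum_eq_zero fun i _ => (key i).2] at hsum
  rw [← integral_const_mul, ← integral_const_mul,
    ← integral_add (hI1.const_mul 2) (hI2.const_mul 2), ← add_zero (∫ x, _ + _), ← hsum,
    ← integral_add ((hI1.const_mul 2).fun_add (hI2.const_mul 2)) hIs]
  refine integral_congr_ae (Filter.Eventually.of_forall fun x => ?_)
  have e : ∀ i, (-(2 * u x * p i x * (x i / (2 * (t + a))))
        - u x ^ 2 / (2 * (t + a)) - 2 * p i x ^ 2 - 2 * u x * q i i x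
        + (u x ^ 2 * (x i / (2 * (t + a))) + 2 * u x * p i x) * (x i / (2 * (t + a))))
        * gaussKer n a x t = -(u x ^ 2 / (2 * (t + a)) * gaussKer n a x t)
        - (2 * gaussKer n a x t) * p i x ^ 2 - (2 * u x * gaussKer n a x t) * q i i x
        + (u x ^ 2 / (4 * (t + a) ^ 2) * gaussKer n a x t) * x i ^ 2 := fun i => by
    field_simp
    ring
  simp only [e, Finset.sum_add_distrib, Finset.sum_sub_distrib, ← Finset.mul_sum,
    Finset.sum_const, Finset.card_univ, Fintype.card_fin, nsmul_eq_mul,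
    EuclideanSpace.real_norm_sq_eq]
  field_simp
  ring

lemma integral_sum_sq_mul_heat_gaussKer (hK : IsCompact K)
    (hw : Continuous w) (hp : ∀ i, Continuous (p i)) (hr : ∀ i, Continuous (r i))
    (hq : ∀ i j, Continuous (q i j)) (hsymm : ∀ i j x, q i j x = q j i x)
    (hw0 : ∀ x, x ∉ K → w x = 0) (hp0 : ∀ i x, x ∉ K → p i x = 0)
    (hq0 : ∀ i j x, x ∉ K → q i j x = 0)
    (hwr : ∀ i x, HasLineDerivAt ℝ w (r i x) x (EuclideanSpace.single i 1))
    (hpq : ∀ i j x, HasLineDerivAt ℝ (p j) (q i j x) x (EuclideanSpace.single i 1))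
    {a t : ℝ} (hta : 0 < t + a) :
    ∫ x, (2 * (∑ i, p i x * r i x) + (∑ i, p i x ^ 2) *
        (‖x‖ ^ 2 / (4 * (t + a) ^ 2) - n / (2 * (t + a)))) * gaussKer n a x t =
      2 * (∫ x, (w x + (∑ i, x i * p i x) / (2 * (t + a)) -
          (1 / 2) * ((∑ i, q i i x) + w x)) ^ 2 * gaussKer n a x t) -
      (1 / 2) * (∫ x, ((∑ i, q i i x) + w x) ^ 2 * gaussKer n a x t) -
      (∫ x, (∑ i, p i x ^ 2) * gaussKer n a x t) / (t + a) := by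
  have hG := continuous_gaussKer n a t
  set D : Fin n → EuclideanSpace ℝ (Fin n) → ℝ := fun i x =>
    ((2 * r i x * p i x + 2 * w x * q i i x
      - (∑ j, 2 * p j x * q i j x) * (x i / (2 * (t + a))) - (∑ j, p j x ^ 2) / (2 * (t + a))
      + (p i x + ∑ j, x j * q i j x) * (p i x / (t + a))
      + (∑ j, x j * p j x) * (q i i x / (t + a)))
      - (2 * w x * p i x - (∑ j, p j x ^ 2) * (x i / (2 * (t + a)))
        + (∑ j, x j * p j x) * (p i x / (t + a))) * (x i / (2 * (t + a))))
        * gaussKer n a x t with hD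
  have key : ∀ i, Integrable (D i) ∧ ∫ x, D i x = 0 := fun i => by
    refine integral_eq_zero_of_hasLineDerivAt (v := EuclideanSpace.single i 1) (V := fun x =>
      (2 * w x * p i x - (∑ j, p j x ^ 2) * (x i / (2 * (t + a)))
        + (∑ j, x j * p j x) * (p i x / (t + a))) * gaussKer n a x t) hK
      (by fun_prop) (by fun_prop) (fun x hx => by simp [hp0 _ x hx]) fun x => ?_
    have hW := hwr i x
    have hP := fun j => hpq i j x
    have hX := fun j => hasLineDerivAt_coord i j x
    have hGd := hasLineDerivAt_gaussKer hta i x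
    unfold HasLineDerivAt at *
    have := ((((hW.const_mul 2).fun_mul (hP i)).fun_sub
      ((HasDerivAt.fun_sum fun j (_ : j ∈ Finset.univ) => (hP j).fun_pow 2).fun_mul
        ((hX i).div_const (2 * (t + a))))).fun_add
      ((HasDerivAt.fun_sum fun j (_ : j ∈ Finset.univ) => (hX j).fun_mul (hP j)).fun_mul
        ((hP i).div_const (t + a)))).fun_mul hGd
    refine this.congr_deriv ?_
    simp [hD, Finset.sum_add_distrib]
    field_simp
    ring
  have hI1 : Integrable fun x => (w x + (∑ i, x i * p i x) / (2 * (t + a)) -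
          (1 / 2) * ((∑ i, q i i x) + w x)) ^ 2 * gaussKer n a x t :=
    Continuous.integrable_of_hasCompactSupport (by fun_prop)
      (HasCompactSupport.intro hK fun x hx => by simp [hp0 _ x hx, hw0 x hx, hq0 _ _ x hx])
  have hI2 : Integrable fun x => ((∑ i, q i i x) + w x) ^ 2 * gaussKer n a x t :=
    Continuous.integrable_of_hasCompactSupport (by fun_prop)
      (HasCompactSupport.intro hK fun x hx => by simp [hw0 x hx, hq0 _ _ x hx])
  have hI3 : Integrable fun x => (∑ i, p i x ^ 2) * gaussKer n a x t :=
    Continuous.integrable_of_hasCompactSupport (by fun_prop)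
      (HasCompactSupport.intro hK fun x hx => by simp [hp0 _ x hx])
  have hsum := integral_finsetSum Finset.univ fun i _ => (key i).1
  have hIs := integrable_finsetSum Finset.univ fun i _ => (key i).1
  rw [Finset.sum_eq_zero fun i _ => (key i).2] at hsum
  have hI12 := (hI1.const_mul 2).sub' (hI2.const_mul (1 / 2))
  rw [← integral_const_mul, ← integral_const_mul, ← integral_div,
    ← integral_sub (hI1.const_mul 2) (hI2.const_mul (1 / 2)),
    ← integral_sub hI12 (hI3.div_const (t + a)), ← add_zero (∫ x, _ - _ / (t + a)), ← hsum,
    ← integral_add (hI12.sub' (hI3.div_const (t + a))) hIs]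
  refine integral_congr_ae (Filter.Eventually.of_forall fun x => ?_)
  have hQ : ∑ i, p i x * ∑ j, x j * q i j x = ∑ i, x i * ∑ j, p j x * q i j x := by
    simp only [Finset.mul_sum]
    rw [Finset.sum_comm]
    refine Finset.sum_congr rfl fun i _ => Finset.sum_congr rfl fun j _ => ?_
    rw [hsymm j i]
    ring
  have e : ∀ i, D i x = (2 * gaussKer n a x t) * (p i x * r i x)
      + (2 * w x * gaussKer n a x t) * q i i x
      - (gaussKer n a x t / (t + a)) * (x i * ∑ j, p j x * q i j x)
      - (∑ j, p j x ^ 2) / (2 * (t + a)) * gaussKer n a x t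
      + (gaussKer n a x t / (t + a)) * p i x ^ 2
      + (gaussKer n a x t / (t + a)) * (p i x * ∑ j, x j * q i j x)
      + ((∑ j, x j * p j x) * gaussKer n a x t / (t + a)) * q i i x
      - (w x * gaussKer n a x t / (t + a)) * (x i * p i x)
      + ((∑ j, p j x ^ 2) * gaussKer n a x t / (4 * (t + a) ^ 2)) * x i ^ 2
      - ((∑ j, x j * p j x) * gaussKer n a x t / (2 * (t + a) ^ 2)) * (x i * p i x) := fun i => by
    simp only [hD, mul_assoc (2 : ℝ) (p _ x), ← Finset.mul_sum]
    field_simp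
    ring
  simp only [e, Finset.sum_add_distrib, Finset.sum_sub_distrib, ← Finset.mul_sum,
    Finset.sum_const, Finset.card_univ, Fintype.card_fin, nsmul_eq_mul,
    EuclideanSpace.real_norm_sq_eq, hQ]
  field_simp
  ring

end IntegrationByParts

section Slices

variable {E : Type*} [NormedAddCommGroup E] [NormedSpace ℝ E]

lemma HasFDerivAt.comp_prodMk_left {g : E × ℝ → ℝ} {g' : E × ℝ →L[ℝ] ℝ} {x : E} {t : ℝ}
    (h : HasFDerivAt g g' (x, t)) :
    HasFDerivAt (fun y => g (y, t)) (g'.comp (ContinuousLinearMap.inl ℝ E ℝ)) x :=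
  h.comp x (hasFDerivAt_prodMk_left x t)

lemma HasFDerivAt.hasDerivAt_comp_prodMk_right {g : E × ℝ → ℝ} {g' : E × ℝ →L[ℝ] ℝ} {x : E}
    {t : ℝ} (h : HasFDerivAt g g' (x, t)) : HasDerivAt (fun s => g (x, s)) (g' (0, 1)) t :=
  h.comp_hasDerivAt t ((hasDerivAt_const t x).prodMk (hasDerivAt_id t))

lemma HasFDerivAt.apply_const {g : E → E →L[ℝ] ℝ} {g' : E →L[ℝ] E →L[ℝ] ℝ} {x : E}
    (h : HasFDerivAt g g' x) (v : E) : HasFDerivAt (fun y => g y v) (g'.flip v) x :=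
  (ContinuousLinearMap.apply ℝ ℝ v).hasFDerivAt.comp x h

end Slices

lemma gradient_apply_eq_fderiv {n : ℕ} (g : EuclideanSpace ℝ (Fin n) → ℝ)
    (x : EuclideanSpace ℝ (Fin n)) (i : Fin n) :
    gradient g x i = fderiv ℝ g x (EuclideanSpace.single i 1) := by
  rw [← inner_gradient_left]
  simp [EuclideanSpace.inner_single_right, -inner_gradient_left]

/-- if `a > 0` and `f ∈ W^{2,∞}(ℝⁿ × (0,∞))` (formalized as: `f` is `C²`
on `ℝⁿ × (0,∞)` and bounded together with its first and second order derivatives) has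
compact support in the space variable, then with `H_a(t) = ∫ f² G_a dx` and
`D_a(t) = ∫ |∇f|² G_a dx`, for every `t > 0` one has
`Ḣ_a(t) = 2∫ f(Δf+∂ₜf)G_a dx + 2D_a(t)` and
`Ḋ_a(t) = 2∫ (∂ₜf + x·∇f/(2(t+a)) − (Δf+∂ₜf)/2)² G_a dx − (1/2)∫ (Δf+∂ₜf)² G_a dx
  − D_a(t)/(t+a)`. -/
theorem stmt_19 (n : ℕ) (a : ℝ) (ha : 0 < a)
    (f : EuclideanSpace ℝ (Fin n) × ℝ → ℝ)
    (hreg : ContDiffOn ℝ 2 f (univ ×ˢ Ioi (0 : ℝ)))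
    (hbdd : ∃ C : ℝ, ∀ p ∈ (univ ×ˢ Ioi (0 : ℝ) :
        Set (EuclideanSpace ℝ (Fin n) × ℝ)),
      |f p| ≤ C ∧ ‖fderiv ℝ f p‖ ≤ C ∧ ‖iteratedFDeriv ℝ 2 f p‖ ≤ C)
    (hsupp : ∃ K : Set (EuclideanSpace ℝ (Fin n)), IsCompact K ∧
      ∀ (x : EuclideanSpace ℝ (Fin n)) (t : ℝ), f (x, t) ≠ 0 → x ∈ K) :
    ∀ t : ℝ, 0 < t →
      HasDerivAt (fun s : ℝ =>
          ∫ x : EuclideanSpace ℝ (Fin n), f (x, s) ^ 2 * gaussKer n a x s)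
        (2 * (∫ x : EuclideanSpace ℝ (Fin n),
            f (x, t) * (slap (fun y => f (y, t)) x + deriv (fun s => f (x, s)) t) *
              gaussKer n a x t) +
          2 * (∫ x : EuclideanSpace ℝ (Fin n),
            ‖gradient (fun y => f (y, t)) x‖ ^ 2 * gaussKer n a x t)) t ∧
      HasDerivAt (fun s : ℝ =>
          ∫ x : EuclideanSpace ℝ (Fin n),
            ‖gradient (fun y => f (y, s)) x‖ ^ 2 * gaussKer n a x s)
        (2 * (∫ x : EuclideanSpace ℝ (Fin n),
            (deriv (fun s => f (x, s)) t +
                ⟪x, gradient (fun y => f (y, t)) x⟫ / (2 * (t + a)) -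
                (1 / 2) * (slap (fun y => f (y, t)) x + deriv (fun s => f (x, s)) t)) ^ 2 *
              gaussKer n a x t) -
          (1 / 2) * (∫ x : EuclideanSpace ℝ (Fin n),
            (slap (fun y => f (y, t)) x + deriv (fun s => f (x, s)) t) ^ 2 *
              gaussKer n a x t) -
          (∫ x : EuclideanSpace ℝ (Fin n),
            ‖gradient (fun y => f (y, t)) x‖ ^ 2 * gaussKer n a x t) / (t + a)) t := by
  intro t ht
  obtain ⟨K, hK, hsupp⟩ := hsupp
  have hta : 0 < t + a := add_pos ht ha
  have hU : IsOpen (univ ×ˢ Ioi (0 : ℝ) : Set (EuclideanSpace ℝ (Fin n) × ℝ)) :=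
    isOpen_univ.prod isOpen_Ioi
  have hmem : ∀ (x : EuclideanSpace ℝ (Fin n)) (s : ℝ), 0 < s → (x, s) ∈
      (univ ×ˢ Ioi (0 : ℝ) : Set (EuclideanSpace ℝ (Fin n) × ℝ)) := fun x s hs => ⟨mem_univ x, hs⟩
  have hf' : ContDiffOn ℝ 1 (fderiv ℝ f) (univ ×ˢ Ioi (0 : ℝ)) :=
    hreg.fderiv_of_isOpen hU (by norm_num)
  have hA : ContinuousOn (fderiv ℝ (fderiv ℝ f)) (univ ×ˢ Ioi (0 : ℝ)) :=
    hf'.continuousOn_fderiv_of_isOpen hU le_rfl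
  have hd1 : ∀ x s, 0 < s → HasFDerivAt f (fderiv ℝ f (x, s)) (x, s) := fun x s hs =>
    ((hreg.contDiffAt (hU.mem_nhds (hmem x s hs))).differentiableAt (by norm_num)).hasFDerivAt
  have hd2 : ∀ x s, 0 < s →
      HasFDerivAt (fderiv ℝ f) (fderiv ℝ (fderiv ℝ f) (x, s)) (x, s) := fun x s hs =>
    ((hf'.contDiffAt (hU.mem_nhds (hmem x s hs))).differentiableAt (by norm_num)).hasFDerivAt
  have hsymm : ∀ x s, 0 < s → ∀ v w, fderiv ℝ (fderiv ℝ f) (x, s) v w =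
      fderiv ℝ (fderiv ℝ f) (x, s) w v := fun x s hs =>
    (hreg.contDiffAt (hU.mem_nhds (hmem x s hs))).isSymmSndFDerivAt (by simp)
  have hz : ∀ x s, x ∉ K → f =ᶠ[nhds (x, s)] fun _ => 0 := fun x s hx =>
    Filter.mem_of_superset ((hK.isClosed.isOpen_compl.preimage continuous_fst).mem_nhds hx)
      fun z hz => by_contra fun h => hz (hsupp z.1 z.2 h)
  have hf0 : ∀ x s, x ∉ K → f (x, s) = 0 := fun x s hx => (hz x s hx).self_of_nhds
  have hp0 : ∀ x s, x ∉ K → fderiv ℝ f (x, s) = 0 := fun x s hx => by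
    rw [(hz x s hx).fderiv_eq, fderiv_const_apply]
  have hq0 : ∀ x s, x ∉ K → fderiv ℝ (fderiv ℝ f) (x, s) = 0 := fun x s hx => by
    rw [(hz x s hx).fderiv.fderiv_eq, fderiv_fun_const, fderiv_zero, Pi.zero_apply]
  set e : Fin n → EuclideanSpace ℝ (Fin n) × ℝ := fun i => (EuclideanSpace.single i 1, 0)
  have hpart : ∀ x s, 0 < s → ∀ i, fderiv ℝ (fun y => f (y, s)) x (EuclideanSpace.single i 1) =
      fderiv ℝ f (x, s) (e i) := fun x s hs i => by
    rw [(hd1 x s hs).comp_prodMk_left.fderiv]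
    rfl
  have hgrad : ∀ x s, 0 < s → ‖gradient (fun y => f (y, s)) x‖ ^ 2 =
      ∑ i, fderiv ℝ f (x, s) (e i) ^ 2 := fun x s hs => by
    simp only [EuclideanSpace.real_norm_sq_eq, gradient_apply_eq_fderiv, hpart x s hs]
  have hinner : ∀ x, ⟪x, gradient (fun y => f (y, t)) x⟫ = ∑ i, x i * fderiv ℝ f (x, t) (e i) :=
    fun x => by
      simp only [PiLp.inner_apply, gradient_apply_eq_fderiv, hpart x t ht]
      exact Finset.sum_congr rfl fun i _ => mul_comm _ _
  have hdt : ∀ x s, 0 < s → HasDerivAt (fun s => f (x, s)) (fderiv ℝ f (x, s) (0, 1)) s :=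
    fun x s hs => (hd1 x s hs).hasDerivAt_comp_prodMk_right
  have hline : ∀ v i x, HasLineDerivAt ℝ (fun y => fderiv ℝ f (y, t) v)
      (fderiv ℝ (fderiv ℝ f) (x, t) (e i) v) x (EuclideanSpace.single i 1) := fun v i x =>
    ((hd2 x t ht).apply_const v).comp_prodMk_left.hasLineDerivAt _
  have hslap : ∀ x, slap (fun y => f (y, t)) x =
      ∑ i, fderiv ℝ (fderiv ℝ f) (x, t) (e i) (e i) := fun x => by
    simp only [slap, hpart _ t ht]
    refine Finset.sum_congr rfl fun i _ => ?_
    rw [((hd2 x t ht).apply_const (e i)).comp_prodMk_left.fderiv]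
    rfl
  have hslice : ∀ s, 0 < s → MapsTo (fun x : EuclideanSpace ℝ (Fin n) => (x, s)) univ
      (univ ×ˢ Ioi (0 : ℝ)) := fun s hs x _ => hmem x s hs
  have hcf : ∀ s, 0 < s → Continuous fun x => f (x, s) := fun s hs => continuousOn_univ.1
    (hreg.continuousOn.comp (by fun_prop) (hslice s hs))
  have hcp : ∀ s, 0 < s → ∀ v, Continuous fun x => fderiv ℝ f (x, s) v := fun s hs v =>
    (continuousOn_univ.1 (hf'.continuousOn.comp (by fun_prop) (hslice s hs))).clm_apply
      continuous_const
  have hcq : ∀ v w, Continuous fun x => fderiv ℝ (fderiv ℝ f) (x, t) v w := fun v w =>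
    ((continuousOn_univ.1 (hA.comp (by fun_prop) (hslice t ht))).clm_apply
      continuous_const).clm_apply continuous_const
  have hcG : ContinuousOn (fun z : EuclideanSpace ℝ (Fin n) × ℝ => gaussKer n a z.1 z.2)
      (univ ×ˢ Ioi (0 : ℝ)) := by
    unfold gaussKer
    refine ContinuousOn.mul (ContinuousOn.rpow_const (by fun_prop) fun z hz => Or.inl ?_)
      (ContinuousOn.rexp (ContinuousOn.div (by fun_prop) (by fun_prop) fun z hz => ?_))
    all_goals
      have : 0 < z.2 := hz.2
      positivity
  have hcH : ContinuousOn (fun z : EuclideanSpace ℝ (Fin n) × ℝ =>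
      ‖z.1‖ ^ 2 / (4 * (z.2 + a) ^ 2) - n / (2 * (z.2 + a))) (univ ×ˢ Ioi (0 : ℝ)) := by
    refine ContinuousOn.sub (ContinuousOn.div (by fun_prop) (by fun_prop) fun z hz => ?_)
      (ContinuousOn.div (by fun_prop) (by fun_prop) fun z hz => ?_)
    all_goals
      have : 0 < z.2 := hz.2
      positivity
  have hf1 := hf'.continuousOn
  have hf0c := hreg.continuousOn
  simp only [(hdt _ t ht).deriv, hslap, hgrad _ t ht, hinner]
  constructor
  · rw [← integral_sq_mul_heat_gaussKer (w := fun x => fderiv ℝ f (x, t) (0, 1)) hK (hcf t ht)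
      (hcp t ht _) (fun i => hcp t ht (e i)) (fun i j => hcq (e i) (e j)) (fun x => hf0 x t)
      (fun i x hx => by rw [hp0 x t hx]; rfl)
      (fun i x => (hd1 x t ht).comp_prodMk_left.hasLineDerivAt _)
      (fun i j x => hline (e j) i x) hta]
    refine hasDerivAt_integral_of_compact_support hK (Φ' := fun x s =>
      (2 * f (x, s) * fderiv ℝ f (x, s) (0, 1) + f (x, s) ^ 2 *
        (‖x‖ ^ 2 / (4 * (s + a) ^ 2) - n / (2 * (s + a)))) * gaussKer n a x s) (fun s hs => ?_)
      ?_ (fun x s hs hx => by simp [hf0 x s hx]) (fun x s hs => ?_) ht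
    · exact ((hcf s hs).pow 2).mul (continuous_gaussKer n a s)
    · exact (((continuousOn_const.mul hf0c).mul (hf1.clm_apply continuousOn_const)).add
        ((hf0c.pow 2).mul hcH)).mul hcG
    · refine (((hdt x s hs).fun_pow 2).fun_mul
        (hasDerivAt_gaussKer (add_pos hs ha) x)).congr_deriv ?_
      ring
  · rw [← integral_sum_sq_mul_heat_gaussKer (w := fun x => fderiv ℝ f (x, t) (0, 1))
      (r := fun i x => fderiv ℝ (fderiv ℝ f) (x, t) (e i) (0, 1)) hK
      (hcp t ht _) (fun i => hcp t ht (e i)) (fun i => hcq (e i) _)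
      (fun i j => hcq (e i) (e j)) (fun i j x => hsymm x t ht _ _)
      (fun x hx => by rw [hp0 x t hx]; rfl) (fun i x hx => by rw [hp0 x t hx]; rfl)
      (fun i j x hx => by rw [hq0 x t hx]; rfl) (fun i x => hline _ i x)
      (fun i j x => hline (e j) i x) hta]
    have key := hasDerivAt_integral_of_compact_support (μ := volume) hK (Φ := fun x s =>
      (∑ i, fderiv ℝ f (x, s) (e i) ^ 2) * gaussKer n a x s) (Φ' := fun x s =>
      (2 * (∑ i, fderiv ℝ f (x, s) (e i) * fderiv ℝ (fderiv ℝ f) (x, s) (e i) (0, 1)) +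
        (∑ i, fderiv ℝ f (x, s) (e i) ^ 2) *
        (‖x‖ ^ 2 / (4 * (s + a) ^ 2) - n / (2 * (s + a)))) * gaussKer n a x s) (fun s hs => ?_)
      ?_ (fun x s hs hx => by simp [hp0 x s hx]) (fun x s hs => ?_) ht
    · refine key.congr_of_eventuallyEq (Filter.mem_of_superset (Ioi_mem_nhds ht) fun s hs => ?_)
      simp only [mem_ofPred_eq, hgrad _ s hs]
    · exact (continuous_finsetSum _ fun i _ => (hcp s hs (e i)).pow 2).mul
        (continuous_gaussKer n a s)
    · exact ((continuousOn_const.mul (continuousOn_finsetSum _ fun i _ =>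
        (hf1.clm_apply continuousOn_const).mul ((hA.clm_apply continuousOn_const).clm_apply
          continuousOn_const))).add ((continuousOn_finsetSum _ fun i _ =>
        (hf1.clm_apply continuousOn_const).pow 2).mul hcH)).mul hcG
    · refine ((HasDerivAt.fun_sum fun i (_ : i ∈ Finset.univ) =>
        ((hd2 x s hs).apply_const (e i)).hasDerivAt_comp_prodMk_right.fun_pow 2).fun_mul
        (hasDerivAt_gaussKer (add_pos hs ha) x)).congr_deriv ?_
      simp only [ContinuousLinearMap.flip_apply, hsymm x s hs (0, 1), add_mul, Finset.mul_sum]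
      congr 1
      · congr 1
        refine Finset.sum_congr rfl fun i _ => ?_
        push_cast
        ring
      · ring
end
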